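/- arXiv:1706.08804 — 2 statements merged into one kernel-verified Lean document; each statement's English description precedes it below -/
import Mathlib

section
/- Let M = (M_p) be a logarithmically convex sequence of positive reals with M_0 = 1, whose quotients m_p := M_{p+1}/M_p tend to infinity, and which admits a nonzero proximate order. For every γ > 0 and every direction θ ∈ (−πγ/2, πγ/2), the class Ã_M(G_γ) coincides with the set of holomorphic functions f on the sectorial region G_γ that are bounded in every proper bounded subsector T ≪ G_γ and admit an M-asymptotic expansion in the direction θ. -/
open Filter Topology Set
open scoped Real

noncomputable section

/-!
We model functions on (subsets of) the Riemann surface of the logarithm through the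
logarithmic chart: a point `z = e^w` of the Riemann surface (with modulus `|z| = exp (Re w)`
and argument `arg z = Im w`) corresponds to the point `w : ℂ`.  A holomorphic function `f`
on a sector corresponds to the holomorphic function `w ↦ f (e^w)` on the corresponding
horizontal strip, and `z → 0` corresponds to `Re w → -∞`.
-/

/-- `M` is a sequence of positive reals with `M 0 = 1`, logarithmically convex,
whose sequence of quotients `m p = M (p+1) / M p` tends to infinity. -/
def GoodSeq (M : ℕ → ℝ) : Prop :=
  M 0 = 1 ∧ (∀ p, 0 < M p) ∧ (∀ p : ℕ, (M (p + 1)) ^ 2 ≤ M p * M (p + 2)) ∧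
    Tendsto (fun p : ℕ => M (p + 1) / M p) atTop atTop

/-- The associated function `M(t) = sup_p log (t^p / M_p)`. -/
def assocM (M : ℕ → ℝ) (t : ℝ) : ℝ := ⨆ p : ℕ, Real.log (t ^ p / M p)

/-- The index `ω(M) = liminf_p log (m_p) / log p`. -/
def omegaM (M : ℕ → ℝ) : ℝ :=
  Filter.liminf (fun p : ℕ => Real.log (M (p + 1) / M p) / Real.log (p : ℝ)) atTop

/-- `ρ` is a proximate order on `(c, ∞)` with limit `ℓ` at infinity:  continuous and
piecewise continuously differentiable (differentiable except possibly on a set `E` of points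
that is finite below any bound, at each of which it has distinct finite lateral derivatives),
nonnegative, with `ρ(r) → ℓ` and `r ρ'(r) log r → 0` as `r → ∞`. -/
def IsProximateOrder (c : ℝ) (ρ : ℝ → ℝ) (ℓ : ℝ) : Prop :=
  ContinuousOn ρ (Ioi c) ∧ (∀ r ∈ Ioi c, 0 ≤ ρ r) ∧ Tendsto ρ atTop (𝓝 ℓ) ∧
    ∃ (E : Set ℝ) (ρ' : ℝ → ℝ),
      (∀ R : ℝ, (E ∩ Iic R).Finite) ∧
      (∀ r ∈ Ioi c \ E, HasDerivAt ρ (ρ' r) r) ∧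
      ContinuousOn ρ' (Ioi c \ E) ∧
      (∀ r ∈ E ∩ Ioi c, ∃ dl dr : ℝ, dl ≠ dr ∧
        HasDerivWithinAt ρ dl (Iio r) r ∧ HasDerivWithinAt ρ dr (Ioi r) r) ∧
      Tendsto (fun r => r * ρ' r * Real.log r) (atTop ⊓ 𝓟 (Ioi c \ E)) (𝓝 0)

/-- The sequence `M` admits a nonzero proximate order: there are a nonzero proximate order
`ρ(t)` and constants `A ≤ B` with `A ≤ log t · (ρ(t) − d_M(t)) ≤ B` for `t` large,
where `d_M(t) = log M(t) / log t`. -/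
def AdmitsNonzeroProximateOrder (M : ℕ → ℝ) : Prop :=
  ∃ (c ℓ : ℝ) (ρ : ℝ → ℝ), 0 < ℓ ∧ IsProximateOrder c ρ ℓ ∧
    ∃ A B : ℝ, ∀ᶠ t in atTop,
      A ≤ Real.log t * (ρ t - Real.log (assocM M t) / Real.log t) ∧
      Real.log t * (ρ t - Real.log (assocM M t) / Real.log t) ≤ B

/-- The unbounded open sector `S(d, γ)` (bisecting direction `d`, opening `γπ`),
in the logarithmic chart. -/
def logSector (d γ : ℝ) : Set ℂ := {w : ℂ | |w.im - d| < γ * π / 2}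

/-- The bounded open sector `S(d, γ, R)` (radius `R`), in the logarithmic chart. -/
def logSectorB (d γ R : ℝ) : Set ℂ :=
  {w : ℂ | |w.im - d| < γ * π / 2 ∧ w.re < Real.log R}

/-- The closure of `S(d, γ, R)` in the Riemann surface of the logarithm
(the vertex is not present), in the logarithmic chart. -/
def logSectorC (d γ R : ℝ) : Set ℂ :=
  {w : ℂ | |w.im - d| ≤ γ * π / 2 ∧ w.re ≤ Real.log R}

/-- `G` is a sectorial region `G(d, γ)`: an open connected subset of `S(d, γ)` that,
for every `0 < β < γ`, contains a bounded sector `S(d, β, ρ)`. -/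
def SectorialRegion (d γ : ℝ) (G : Set ℂ) : Prop :=
  IsOpen G ∧ IsConnected G ∧ G ⊆ logSector d γ ∧
    ∀ β : ℝ, 0 < β → β < γ → ∃ ρ : ℝ, 0 < ρ ∧ logSectorB d β ρ ⊆ G

/-- The bounded sector `S(d, β, r)` is a proper subsector of `G` (written `T ≪ G`):
its closure in the Riemann surface of the logarithm is contained in `G`. -/
def ProperSubsector (G : Set ℂ) (d β r : ℝ) : Prop :=
  0 < β ∧ 0 < r ∧ logSectorC d β r ⊆ G

/-- `f` (defined on `D`) is `M`-flat in the direction `θ`: there are `r, C, A > 0` such that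
the segment `(0, r e^{iθ}]` lies in `D` and `|f(z)| ≤ C A^p M_p |z|^p` on it, for all `p`. -/
def MFlatDir (M : ℕ → ℝ) (f : ℂ → ℂ) (D : Set ℂ) (θ : ℝ) : Prop :=
  ∃ r C A : ℝ, 0 < r ∧ 0 < C ∧ 0 < A ∧
    (∀ x : ℝ, x ≤ Real.log r → (⟨x, θ⟩ : ℂ) ∈ D) ∧
    ∀ x : ℝ, x ≤ Real.log r → ∀ p : ℕ,
      ‖f ⟨x, θ⟩‖ ≤ C * A ^ p * M p * Real.exp x ^ p

/-- `f` (bounded, defined on `D`) is Beurling `M`-flat in the direction `θ`. -/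
def BeurlingFlatDir (M : ℕ → ℝ) (f : ℂ → ℂ) (D : Set ℂ) (θ : ℝ) : Prop :=
  ∀ c2 : ℝ, 0 < c2 → ∃ c1 : ℝ, 0 < c1 ∧
    ∀ w ∈ D, w.im = θ →
      ‖f w‖ ≤ c1 * Real.exp (-assocM M (1 / (c2 * Real.exp w.re)))

/-- `f` admits `Σ a_n z^n` as its `M`-asymptotic expansion in the region `G`:  on every
proper subsector `T ≪ G` there are `C, A > 0` with
`|f(z) − Σ_{n<p} a_n z^n| ≤ C A^p M_p |z|^p` for all `z ∈ T`, `p ∈ ℕ`.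
(In the logarithmic chart, `z = e^w`.) -/
def AsympExpandsOn (M : ℕ → ℝ) (f : ℂ → ℂ) (a : ℕ → ℂ) (G : Set ℂ) : Prop :=
  ∀ d β r : ℝ, ProperSubsector G d β r → ∃ C A : ℝ, 0 < C ∧ 0 < A ∧
    ∀ w ∈ logSectorB d β r, ∀ p : ℕ,
      ‖f w - ∑ n ∈ Finset.range p, a n * Complex.exp w ^ n‖
        ≤ C * A ^ p * M p * Real.exp w.re ^ p

/-- `f` admits `Σ a_n z^n` as its `M`-asymptotic expansion in the direction `θ`: there are
`r, C, A > 0` such that the segment `(0, r e^{iθ}]` lies in `G` and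
`|f(z) − Σ_{n<p} a_n z^n| ≤ C A^p M_p |z|^p` on it, for all `p`. -/
def AsympExpandsDir (M : ℕ → ℝ) (f : ℂ → ℂ) (a : ℕ → ℂ) (G : Set ℂ) (θ : ℝ) : Prop :=
  ∃ r C A : ℝ, 0 < r ∧ 0 < C ∧ 0 < A ∧
    (∀ x : ℝ, x ≤ Real.log r → (⟨x, θ⟩ : ℂ) ∈ G) ∧
    ∀ x : ℝ, x ≤ Real.log r → ∀ p : ℕ,
      ‖f (⟨x, θ⟩ : ℂ) - ∑ n ∈ Finset.range p, a n * Complex.exp (⟨x, θ⟩ : ℂ) ^ n‖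
        ≤ C * A ^ p * M p * Real.exp x ^ p

/-- The derivative with respect to the base variable `z = e^w`, in the logarithmic chart:
`(d/dz) f = e^{-w} (d/dw) f`. -/
def zderiv (f : ℂ → ℂ) : ℂ → ℂ := fun w => Complex.exp (-w) * deriv f w

/-- The filter of approach to the vertex (`z → 0`, i.e. `Re w → -∞`) within `D`. -/
def vertexFilter (D : Set ℂ) : Filter ℂ := Filter.comap Complex.re atBot ⊓ 𝓟 D

/-- The class `Ã^u_M(S)` contains no nontrivial function whose uniform `M`-asymptotic
expansion on `S` is the null power series. -/
def UniformQuasianalytic (M : ℕ → ℝ) (S : Set ℂ) : Prop :=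
  ∀ f : ℂ → ℂ, DifferentiableOn ℂ f S →
    (∃ C A : ℝ, 0 < C ∧ 0 < A ∧
      ∀ w ∈ S, ∀ p : ℕ, ‖f w‖ ≤ C * A ^ p * M p * Real.exp w.re ^ p) →
    ∀ w ∈ S, f w = 0

/-- Quotients of the sequence. -/
def quot (M : ℕ → ℝ) (p : ℕ) : ℝ := M (p + 1) / M p

lemma quot_pos {M : ℕ → ℝ} (hM : GoodSeq M) (p : ℕ) : 0 < quot M p :=
  div_pos (hM.2.1 _) (hM.2.1 _)

lemma quot_mono {M : ℕ → ℝ} (hM : GoodSeq M) : Monotone (quot M) := by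
  refine monotone_nat_of_le_succ fun p => ?_
  have h0 := hM.2.1 p
  have h1 := hM.2.1 (p + 1)
  have h2 := hM.2.2.1 p
  unfold quot
  rw [div_le_div_iff₀ h0 h1]
  nlinarith

lemma M_succ {M : ℕ → ℝ} (hM : GoodSeq M) (p : ℕ) : M (p + 1) = M p * quot M p := by
  have h0 := hM.2.1 p
  unfold quot
  field_simp

lemma M_up {M : ℕ → ℝ} (hM : GoodSeq M) (n k q : ℕ) (h : n + k ≤ q + 1) :
    M (n + k) ≤ M n * quot M q ^ k := by
  induction k with
  | zero => simp
  | succ k ih =>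
    have ih := ih (by omega)
    rw [← add_assoc, M_succ hM, pow_succ, ← mul_assoc]
    exact mul_le_mul ih (quot_mono hM (by omega)) (quot_pos hM _).le
      (mul_nonneg (hM.2.1 _).le (pow_nonneg (quot_pos hM _).le _))

lemma M_down {M : ℕ → ℝ} (hM : GoodSeq M) (k q : ℕ) :
    M q * quot M q ^ k ≤ M (q + k) := by
  induction k with
  | zero => simp
  | succ k ih =>
    rw [← add_assoc, M_succ hM, pow_succ, ← mul_assoc]
    exact mul_le_mul ih (quot_mono hM (by omega)) (quot_pos hM _).le (hM.2.1 _).le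

lemma quot_sup {M : ℕ → ℝ} (hM : GoodSeq M) (q j : ℕ) :
    quot M q ^ j / M j ≤ quot M q ^ q / M q := by
  have hj := hM.2.1 j
  have hq := hM.2.1 q
  have hm := quot_pos hM q
  rw [div_le_div_iff₀ hj hq]
  rcases le_total j q with h | h
  · obtain ⟨k, rfl⟩ := Nat.exists_eq_add_of_le h
    have := M_up hM j k (j + k) (by omega)
    rw [pow_add]
    have h2 := mul_le_mul_of_nonneg_left this (pow_nonneg hm.le j)
    nlinarith
  · obtain ⟨k, rfl⟩ := Nat.exists_eq_add_of_le h
    have := M_down hM k q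
    rw [pow_add]
    have h2 := mul_le_mul_of_nonneg_left this (pow_nonneg hm.le q)
    nlinarith

lemma assoc_bdd {M : ℕ → ℝ} (hM : GoodSeq M) {t : ℝ} (ht : 0 < t) :
    BddAbove (range fun p : ℕ => Real.log (t ^ p / M p)) := by
  obtain ⟨q, hq⟩ := (hM.2.2.2.eventually_ge_atTop t).exists
  refine ⟨Real.log (quot M q ^ q / M q), ?_⟩
  rintro _ ⟨j, rfl⟩
  refine Real.log_le_log (div_pos (pow_pos ht _) (hM.2.1 _)) (le_trans ?_ (quot_sup hM q j))
  exact div_le_div_of_nonneg_right (pow_le_pow_left₀ ht.le hq j) (hM.2.1 _).le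

lemma log_div_eq {M : ℕ → ℝ} (hM : GoodSeq M) {t : ℝ} (ht : 0 < t) (p : ℕ) :
    Real.log (t ^ p / M p) = p * Real.log t - Real.log (M p) := by
  rw [Real.log_div (pow_pos ht _).ne' (hM.2.1 _).ne', Real.log_pow]

lemma assoc_ge {M : ℕ → ℝ} (hM : GoodSeq M) {t : ℝ} (ht : 0 < t) (p : ℕ) :
    p * Real.log t - Real.log (M p) ≤ assocM M t := by
  rw [← log_div_eq hM ht]
  exact le_ciSup (assoc_bdd hM ht) p

lemma assoc_quot {M : ℕ → ℝ} (hM : GoodSeq M) (q : ℕ) :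
    assocM M (quot M q) ≤ q * Real.log (quot M q) - Real.log (M q) := by
  rw [← log_div_eq hM (quot_pos hM q)]
  exact ciSup_le fun j => Real.log_le_log (div_pos (pow_pos (quot_pos hM q) _) (hM.2.1 _))
    (quot_sup hM q j)

/-- Monotonicity from a nonnegative derivative off a locally finite set. -/
lemma mono_off_finite (g g' : ℝ → ℝ) (E : Set ℝ) :
    ∀ (n : ℕ) (a b : ℝ), a ≤ b → (E ∩ Ioo a b).Finite → (E ∩ Ioo a b).ncard ≤ n →
      ContinuousOn g (Icc a b) → (∀ x ∈ Ioo a b \ E, HasDerivAt g (g' x) x ∧ 0 ≤ g' x) →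
      g a ≤ g b := by
  intro n
  induction n with
  | zero =>
    intro a b hab hfin hn hc hd
    have hE : E ∩ Ioo a b = ∅ := (Set.ncard_eq_zero hfin).1 (by omega)
    have hd' : ∀ x ∈ Ioo a b, HasDerivAt g (g' x) x ∧ 0 ≤ g' x := by
      intro x hx
      refine hd x ⟨hx, fun hxE => ?_⟩
      have : x ∈ E ∩ Ioo a b := ⟨hxE, hx⟩
      rw [hE] at this
      exact this
    refine monotoneOn_of_deriv_nonneg (convex_Icc a b) hc ?_ ?_ (left_mem_Icc.2 hab)
      (right_mem_Icc.2 hab) hab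
    · rw [interior_Icc]
      exact fun x hx => (hd' x hx).1.differentiableAt.differentiableWithinAt
    · rw [interior_Icc]
      intro x hx
      rw [(hd' x hx).1.deriv]
      exact (hd' x hx).2
  | succ n ih =>
    intro a b hab hfin hn hc hd
    rcases (E ∩ Ioo a b).eq_empty_or_nonempty with hE | ⟨e, heE, hea, heb⟩
    · exact ih a b hab hfin (by simp [hE]) hc hd
    · have s1 : E ∩ Ioo a e ⊂ E ∩ Ioo a b := by
        refine ⟨fun x hx => ⟨hx.1, hx.2.1, hx.2.2.trans heb⟩, fun h => ?_⟩
        exact lt_irrefl _ (h ⟨heE, hea, heb⟩).2.2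
      have s2 : E ∩ Ioo e b ⊂ E ∩ Ioo a b := by
        refine ⟨fun x hx => ⟨hx.1, hea.trans hx.2.1, hx.2.2⟩, fun h => ?_⟩
        exact lt_irrefl _ (h ⟨heE, hea, heb⟩).2.1
      have n1 := Set.ncard_lt_ncard s1 hfin
      have n2 := Set.ncard_lt_ncard s2 hfin
      have r1 := ih a e hea.le (hfin.subset s1.1) (by omega)
        (hc.mono (Icc_subset_Icc le_rfl heb.le))
        (fun x hx => hd x ⟨⟨hx.1.1, hx.1.2.trans heb⟩, hx.2⟩)
      have r2 := ih e b heb.le (hfin.subset s2.1) (by omega)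
        (hc.mono (Icc_subset_Icc hea.le le_rfl))
        (fun x hx => hd x ⟨⟨hea.trans hx.1.1, hx.1.2⟩, hx.2⟩)
      exact r1.trans r2

/-- A sequence admitting a nonzero proximate order has an associated function that at least
doubles under a fixed dilation. -/
lemma assoc_double {M : ℕ → ℝ} (hM : GoodSeq M) (hPO : AdmitsNonzeroProximateOrder M) :
    ∃ l T : ℝ, 1 < l ∧ 0 < T ∧ ∀ t, T ≤ t → 2 * assocM M t ≤ assocM M (l * t) := by
  obtain ⟨c, ℓ, ρ, hℓ, ⟨hcont, -, hlim, E, ρ', hE, hder, -, -, hlim'⟩, A, B, hAB⟩ := hPO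
  have e1 : ∀ᶠ t in atTop, 3 * ℓ / 4 < ρ t := hlim.eventually (lt_mem_nhds (by linarith))
  have e2 : ∀ᶠ r in atTop, r ∈ Ioi c \ E → -(ℓ / 4) < r * ρ' r * Real.log r := by
    have := hlim'.eventually (lt_mem_nhds (show -(ℓ / 4) < 0 by linarith))
    rwa [eventually_inf_principal] at this
  obtain ⟨T, hT⟩ := eventually_atTop.1 (e1.and (e2.and (hAB.and
    ((eventually_gt_atTop c).and ((eventually_gt_atTop 1).and
      (eventually_gt_atTop (M 1)))))))
  set l := Real.exp (2 / ℓ * (Real.log 2 + |B - A| + 1)) with hl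
  have hlog2 : 0 < Real.log 2 := Real.log_pos (by norm_num)
  have hexp : 0 < 2 / ℓ * (Real.log 2 + |B - A| + 1) := by positivity
  have hl1 : 1 < l := Real.one_lt_exp_iff.2 hexp
  have hlogl : ℓ / 2 * Real.log l = Real.log 2 + |B - A| + 1 := by
    rw [hl, Real.log_exp]; field_simp
  refine ⟨l, max T 1, hl1, by positivity, fun t ht => ?_⟩
  have htT : T ≤ t := (le_max_left _ _).trans ht
  have hlt : t ≤ l * t := by nlinarith [le_max_right T 1]
  obtain ⟨-, -, ⟨hA1, -⟩, htc, ht1, htM⟩ := hT t htT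
  obtain ⟨-, -, ⟨-, hB2⟩, -, hlt1, hltM⟩ := hT (l * t) (htT.trans hlt)
  have pos : ∀ s, 1 < s → M 1 < s → 0 < assocM M s := by
    intro s hs hs'
    have := assoc_ge hM (zero_lt_one.trans hs) 1
    have h3 := Real.log_lt_log (hM.2.1 1) hs'
    simp only [Nat.cast_one, one_mul] at this
    linarith
  have p1 := pos t ht1 htM
  have p2 := pos (l * t) hlt1 hltM
  have lt1 := Real.log_pos ht1
  have lt2 := Real.log_pos hlt1
  rw [mul_sub, mul_div_cancel₀ _ lt1.ne'] at hA1
  rw [mul_sub, mul_div_cancel₀ _ lt2.ne'] at hB2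
  have hmono : (Real.log t * ρ t - ℓ / 2 * Real.log t) ≤
      (Real.log (l * t) * ρ (l * t) - ℓ / 2 * Real.log (l * t)) := by
    refine mono_off_finite (fun s => Real.log s * ρ s - ℓ / 2 * Real.log s)
      (fun s => (s⁻¹ * ρ s + Real.log s * ρ' s) - ℓ / 2 * s⁻¹) E _ t (l * t) hlt
      ((hE (l * t)).subset fun x hx => ⟨hx.1, hx.2.2.le⟩) le_rfl ?_ ?_
    · have cl : ContinuousOn Real.log (Icc t (l * t)) :=
        Real.continuousOn_log.mono fun x hx => by
          have : 0 < x := by linarith [hx.1]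
          simpa using this.ne'
      have cr : ContinuousOn ρ (Icc t (l * t)) :=
        hcont.mono fun x hx => lt_of_lt_of_le htc hx.1
      exact (cl.mul cr).sub (continuousOn_const.mul cl)
    · rintro x ⟨hx, hxE⟩
      have hx0 : 0 < x := by linarith [hx.1]
      have hxc : x ∈ Ioi c \ E := ⟨htc.trans hx.1, hxE⟩
      obtain ⟨q1, q2, -⟩ := hT x (htT.trans hx.1.le)
      have q2 := q2 hxc
      have dl := Real.hasDerivAt_log hx0.ne'
      refine ⟨(dl.mul (hder x hxc)).sub (dl.const_mul _), ?_⟩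
      have : (x⁻¹ * ρ x + Real.log x * ρ' x) - ℓ / 2 * x⁻¹ =
          x⁻¹ * (ρ x + x * ρ' x * Real.log x - ℓ / 2) := by
        field_simp
      rw [this]
      exact mul_nonneg (by positivity) (by linarith)
  have hll : Real.log (l * t) = Real.log l + Real.log t :=
    Real.log_mul (by linarith) (by linarith)
  have : Real.log (2 * assocM M t) ≤ Real.log (assocM M (l * t)) := by
    rw [Real.log_mul (by norm_num) p1.ne']
    have hab := le_abs_self (B - A)
    have e : ℓ / 2 * Real.log (l * t) = ℓ / 2 * Real.log l + ℓ / 2 * Real.log t := by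
      rw [hll]; ring
    linarith
  exact (Real.log_le_log_iff (by positivity) p2).1 this

/-- Moderate growth. -/
lemma mod_growth {M : ℕ → ℝ} (hM : GoodSeq M) (hPO : AdmitsNonzeroProximateOrder M)
    (κ : ℕ) (hκ : 0 < κ) :
    ∃ B : ℝ, 1 ≤ B ∧ ∀ p : ℕ, quot M (κ * p) ^ p ≤ B ^ p * M p := by
  obtain ⟨l, T, hl, hT, hdb⟩ := assoc_double hM hPO
  have l0 : 0 < l := by linarith
  have hev : ∀ᶠ q : ℕ in atTop, l * T ≤ quot M q := hM.2.2.2.eventually_ge_atTop (l * T)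
  obtain ⟨N, hN⟩ := eventually_atTop.1 hev
  have hbig : ∀ p, N ≤ p → quot M (κ * p) ^ p ≤ (l ^ (1 + κ)) ^ p * M p := by
    intro p hp
    have hq := hN (κ * p) (hp.trans (Nat.le_mul_of_pos_left p hκ))
    set t := quot M (κ * p) with ht
    have t0 : 0 < t := quot_pos hM _
    have u0 : 0 < t / l := div_pos t0 l0
    have h1 := hdb (t / l) (by rw [le_div_iff₀ l0]; linarith)
    rw [mul_div_cancel₀ _ l0.ne'] at h1
    have h2 := assoc_quot hM (κ * p)
    rw [← ht] at h2
    have h3 := assoc_ge hM u0 (κ * p)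
    have h4 := assoc_ge hM u0 p
    rw [Real.log_div t0.ne' l0.ne'] at h3 h4
    push_cast at h2 h3
    have hMp := hM.2.1 p
    rw [← Real.log_le_log_iff (pow_pos t0 _) (by positivity),
      Real.log_mul (by positivity) hMp.ne', Real.log_pow, Real.log_pow, Real.log_pow]
    push_cast
    nlinarith
  refine ⟨l ^ (1 + κ) + ∑ p ∈ Finset.range N, quot M (κ * p) ^ p / M p, ?_, ?_⟩
  · have : 0 ≤ ∑ p ∈ Finset.range N, quot M (κ * p) ^ p / M p :=
      Finset.sum_nonneg fun p _ => div_nonneg (pow_nonneg (quot_pos hM _).le _) (hM.2.1 _).le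
    have := one_le_pow₀ hl.le (n := 1 + κ)
    linarith
  · intro p
    have hnn : ∀ p ∈ Finset.range N, 0 ≤ quot M (κ * p) ^ p / M p :=
      fun p _ => div_nonneg (pow_nonneg (quot_pos hM _).le _) (hM.2.1 _).le
    have hs := Finset.sum_nonneg hnn
    have hl1 := one_le_pow₀ hl.le (n := 1 + κ)
    rcases le_or_gt N p with h | h
    · refine (hbig p h).trans (mul_le_mul_of_nonneg_right ?_ (hM.2.1 p).le)
      exact pow_le_pow_left₀ (by positivity) (by linarith) p
    · rcases Nat.eq_zero_or_pos p with rfl | hp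
      · simp [hM.1]
      · rw [← div_le_iff₀ (hM.2.1 p)]
        have := Finset.single_le_sum hnn (Finset.mem_range.2 h)
        refine le_trans ?_ (le_self_pow₀ (by linarith) hp.ne')
        linarith

/-- A Phragmén–Lindelöf estimate in a half-strip (`b` may be negative). -/
lemma half_strip (F : ℂ → ℂ) (b C : ℝ) (hb : b ≠ 0) (hC : 0 ≤ C) (q : ℕ)
    (hd : DifferentiableOn ℂ F {w : ℂ | w.re ≤ 0 ∧ w.im ∈ uIcc 0 b})
    (hbd : ∀ w : ℂ, w.re ≤ 0 → w.im ∈ uIcc 0 b → ‖F w‖ ≤ C)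
    (h0 : ∀ w : ℂ, w.re ≤ 0 → w.im = 0 → ‖F w‖ ≤ C * Real.exp (q * w.re))
    (w : ℂ) (hw : w.re ≤ 0) (hwi : w.im ∈ uIcc 0 b) :
    ‖F w‖ ≤ C * Real.exp (q * (w.re * (1 - w.im / b))) := by
  have hratio : ∀ y ∈ uIcc 0 b, 0 ≤ 1 - y / b ∧ 1 - y / b ≤ 1 ∧ y ^ 2 ≤ b ^ 2 := by
    intro y hy
    rcases lt_or_gt_of_ne hb with hb | hb
    · rw [uIcc_of_ge hb.le] at hy
      have h1 : y / b ≤ 1 := by rw [div_le_one_of_neg hb]; exact hy.1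
      have h2 : 0 ≤ y / b := div_nonneg_of_nonpos hy.2 hb.le
      exact ⟨by linarith, by linarith, by nlinarith [hy.1, hy.2]⟩
    · rw [uIcc_of_le hb.le] at hy
      have h1 : y / b ≤ 1 := by rw [div_le_one hb]; exact hy.2
      have h2 : 0 ≤ y / b := div_nonneg hy.1 hb.le
      exact ⟨by linarith, by linarith, by nlinarith [hy.1, hy.2]⟩
  have main : ∀ ε : ℝ, 0 < ε → ‖F w‖ ≤
      C * Real.exp (ε * b ^ 2) * Real.exp (ε * (w.re ^ 2 - w.im ^ 2)) *
        Real.exp (q * (w.re * (1 - w.im / b))) := by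
    intro ε hε
    set P : ℂ → ℂ := fun v => -(q : ℂ) * (v + Complex.I * v ^ 2 / (2 * b)) - ε * v ^ 2 with hP
    have hPre : ∀ v : ℂ, (P v).re =
        -(q * (v.re * (1 - v.im / b))) - ε * (v.re ^ 2 - v.im ^ 2) := by
      intro v
      have e : Complex.I * v ^ 2 / (2 * b) = ((1 / (2 * b) : ℝ) : ℂ) * (Complex.I * v ^ 2) := by
        push_cast; ring
      have e2 : -(q : ℂ) = ((-(q : ℝ) : ℝ) : ℂ) := by push_cast; rfl
      simp only [hP]
      rw [e, e2, Complex.sub_re, Complex.re_ofReal_mul, Complex.re_ofReal_mul, Complex.add_re,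
        Complex.re_ofReal_mul, pow_two]
      simp only [Complex.mul_re, Complex.mul_im, Complex.I_re, Complex.I_im]
      field_simp
      ring
    set H : ℂ → ℂ := fun v => F v * Complex.exp (P v) with hH
    set R : ℝ := max (max (q / ε) (-w.re)) 1 with hR
    have hR1 : 1 ≤ R := le_max_right _ _
    have hRq : q ≤ ε * R := by
      have : q / ε ≤ R := (le_max_left _ _).trans (le_max_left _ _)
      rw [div_le_iff₀ hε] at this
      linarith
    have hRw : -R ≤ w.re := by
      have : -w.re ≤ R := (le_max_right _ _).trans (le_max_left _ _)
      linarith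
    have hmm : min 0 b < max 0 b := min_lt_max.2 hb.symm
    set U : Set ℂ := Ioo (-R) 0 ×ℂ Ioo (min 0 b) (max 0 b) with hU
    have hcl : closure U = Icc (-R) 0 ×ℂ uIcc 0 b := by
      rw [hU, Complex.closure_reProdIm, closure_Ioo (by linarith), closure_Ioo hmm.ne]
      rfl
    have hUo : IsOpen U := isOpen_Ioo.reProdIm isOpen_Ioo
    have hUb : Bornology.IsBounded U :=
      (Metric.isBounded_Ioo _ _).reProdIm (Metric.isBounded_Ioo _ _)
    have hHd : DiffContOnCl ℂ H U := by
      refine DifferentiableOn.diffContOnCl ?_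
      rw [hcl]
      refine DifferentiableOn.mul (hd.mono fun v hv => ⟨hv.1.2, hv.2⟩) ?_
      refine Differentiable.differentiableOn ?_
      simp only [hP]
      fun_prop
    have hnorm : ∀ v, ‖H v‖ = ‖F v‖ * Real.exp ((P v).re) := by
      intro v; simp only [hH]; rw [norm_mul, Complex.norm_exp]
    have hfr : ∀ v ∈ frontier U, ‖H v‖ ≤ C * Real.exp (ε * b ^ 2) := by
      intro v hv
      rw [frontier, hUo.interior_eq, hcl] at hv
      obtain ⟨⟨⟨hv1, hv2⟩, hv3⟩, hv4⟩ := hv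
      change -R ≤ v.re at hv1
      change v.re ≤ 0 at hv2
      change v.im ∈ uIcc 0 b at hv3
      obtain ⟨r1, r2, r3⟩ := hratio _ hv3
      have hεb : ε * v.im ^ 2 ≤ ε * b ^ 2 := mul_le_mul_of_nonneg_left r3 hε.le
      have hεx : 0 ≤ ε * v.re ^ 2 := by positivity
      have hq0 : (0 : ℝ) ≤ q := Nat.cast_nonneg q
      rw [hnorm, hPre]
      have gen : q * (-v.re * (1 - v.im / b)) ≤ ε * v.re ^ 2 →
          ‖F v‖ * Real.exp (-(q * (v.re * (1 - v.im / b))) - ε * (v.re ^ 2 - v.im ^ 2)) ≤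
            C * Real.exp (ε * b ^ 2) := by
        intro h
        refine mul_le_mul (hbd v hv2 hv3) (Real.exp_le_exp.2 ?_) (Real.exp_pos _).le hC
        linarith
      by_cases c1 : v.re = 0
      · exact gen (by rw [c1]; simp)
      by_cases c2 : v.re = -R
      · refine gen ?_
        rw [c2, neg_neg]
        have a1 : R * (1 - v.im / b) ≤ R := by nlinarith
        calc (q : ℝ) * (R * (1 - v.im / b)) ≤ q * R := mul_le_mul_of_nonneg_left a1 hq0
          _ ≤ ε * R * R := mul_le_mul_of_nonneg_right hRq (by linarith)
          _ = ε * (-R) ^ 2 := by ring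
      by_cases c3 : v.im = 0
      · have := h0 v hv2 c3
        rw [c3]
        calc ‖F v‖ * Real.exp (-(q * (v.re * (1 - 0 / b))) - ε * (v.re ^ 2 - 0 ^ 2))
            ≤ C * Real.exp (q * v.re) *
              Real.exp (-(q * (v.re * (1 - 0 / b))) - ε * (v.re ^ 2 - 0 ^ 2)) :=
              mul_le_mul_of_nonneg_right this (Real.exp_pos _).le
          _ = C * Real.exp (- (ε * v.re ^ 2)) := by
              rw [mul_assoc, ← Real.exp_add]; congr 2; ring
          _ ≤ C * Real.exp (ε * b ^ 2) := by
              refine mul_le_mul_of_nonneg_left (Real.exp_le_exp.2 ?_) hC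
              have : 0 ≤ ε * b ^ 2 := by positivity
              linarith
      by_cases c4 : v.im = b
      · refine gen ?_
        rw [c4, div_self hb]
        simpa using hεx
      exfalso
      apply hv4
      refine ⟨⟨lt_of_le_of_ne hv1 (Ne.symm c2), lt_of_le_of_ne hv2 c1⟩,
        lt_of_le_of_ne hv3.1 ?_, lt_of_le_of_ne hv3.2 ?_⟩
      · rcases min_choice 0 b with h | h <;> rw [h]
        · exact Ne.symm c3
        · exact Ne.symm c4
      · rcases max_choice 0 b with h | h <;> rw [h]
        · exact c3
        · exact c4
    have hwU : w ∈ closure U := by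
      rw [hcl]; exact ⟨⟨hRw, hw⟩, hwi⟩
    have := Complex.norm_le_of_forall_mem_frontier_norm_le hUb hHd hfr hwU
    rw [hnorm, hPre] at this
    calc ‖F w‖ = ‖F w‖ * Real.exp (-(q * (w.re * (1 - w.im / b))) - ε * (w.re ^ 2 - w.im ^ 2)) *
          (Real.exp (ε * (w.re ^ 2 - w.im ^ 2)) * Real.exp (q * (w.re * (1 - w.im / b)))) := by
          rw [mul_assoc, ← Real.exp_add, ← Real.exp_add]
          ring_nf
          simp
      _ ≤ C * Real.exp (ε * b ^ 2) *
          (Real.exp (ε * (w.re ^ 2 - w.im ^ 2)) * Real.exp (q * (w.re * (1 - w.im / b)))) :=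
          mul_le_mul_of_nonneg_right this (by positivity)
      _ = _ := by ring
  have hlim : Tendsto (fun ε : ℝ => C * Real.exp (ε * b ^ 2) *
      Real.exp (ε * (w.re ^ 2 - w.im ^ 2)) * Real.exp (q * (w.re * (1 - w.im / b))))
      (𝓝[>] 0) (𝓝 (C * Real.exp (0 * b ^ 2) *
      Real.exp (0 * (w.re ^ 2 - w.im ^ 2)) * Real.exp (q * (w.re * (1 - w.im / b))))) := by
    refine (Continuous.tendsto ?_ 0).mono_left nhdsWithin_le_nhds
    fun_prop
  have := ge_of_tendsto hlim (eventually_mem_nhdsWithin.mono fun ε hε => main ε hε)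
  simpa using this

lemma coeff_bound {M : ℕ → ℝ} {f : ℂ → ℂ} {a : ℕ → ℂ} {θ x1 C A : ℝ}
    (hray : ∀ x : ℝ, x ≤ x1 → ∀ p : ℕ,
      ‖f (⟨x, θ⟩ : ℂ) - ∑ n ∈ Finset.range p, a n * Complex.exp (⟨x, θ⟩ : ℂ) ^ n‖
        ≤ C * A ^ p * M p * Real.exp x ^ p) (n : ℕ) :
    ‖a n‖ ≤ C * A ^ n * M n := by
  have key : ∀ x ≤ x1, ‖a n‖ ≤ C * A ^ n * M n + C * A ^ (n + 1) * M (n + 1) * Real.exp x := by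
    intro x hx
    have h1 := hray x hx n
    have h2 := hray x hx (n + 1)
    rw [Finset.sum_range_succ] at h2
    set z := Complex.exp (⟨x, θ⟩ : ℂ) with hz
    have hzn : ‖z‖ = Real.exp x := by rw [hz, Complex.norm_exp]
    set S := ∑ n ∈ Finset.range n, a n * z ^ n
    have e : a n * z ^ n = (f ⟨x, θ⟩ - S) - (f ⟨x, θ⟩ - (S + a n * z ^ n)) := by ring
    have h3 : ‖a n‖ * Real.exp x ^ n ≤
        C * A ^ n * M n * Real.exp x ^ n + C * A ^ (n + 1) * M (n + 1) * Real.exp x ^ (n + 1) := by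
      have hN : ‖a n‖ * Real.exp x ^ n = ‖a n * z ^ n‖ := by rw [norm_mul, norm_pow, hzn]
      rw [hN, e]
      exact (norm_sub_le _ _).trans (add_le_add h1 h2)
    have hpos : 0 < Real.exp x ^ n := by positivity
    refine le_of_mul_le_mul_right (h3.trans (le_of_eq ?_)) hpos
    ring
  have hlim : Tendsto (fun x : ℝ => C * A ^ n * M n + C * A ^ (n + 1) * M (n + 1) * Real.exp x)
      atBot (𝓝 (C * A ^ n * M n + C * A ^ (n + 1) * M (n + 1) * 0)) :=
    tendsto_const_nhds.add (tendsto_const_nhds.mul Real.tendsto_exp_atBot)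
  rw [mul_zero, add_zero] at hlim
  exact ge_of_tendsto hlim ((eventually_le_atBot x1).mono key)

lemma core {M : ℕ → ℝ} (hM : GoodSeq M) {f : ℂ → ℂ} {a : ℕ → ℂ} {θ b x1 C A K B : ℝ} {κ : ℕ}
    (hb : b ≠ 0) (hC : 0 < C) (hA : 0 < A) (hK0 : 0 ≤ K) (hκ : 0 < κ) (hB1 : 1 ≤ B)
    (hB : ∀ p : ℕ, quot M (κ * p) ^ p ≤ B ^ p * M p)
    (hx1 : -Real.log (2 * A * quot M 0) ≤ x1)
    (hd : DifferentiableOn ℂ f {w : ℂ | w.re ≤ x1 ∧ w.im - θ ∈ uIcc 0 b})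
    (hK : ∀ w : ℂ, w.re ≤ x1 → w.im - θ ∈ uIcc 0 b → ‖f w‖ ≤ K)
    (hray : ∀ x : ℝ, x ≤ x1 → ∀ p : ℕ,
      ‖f (⟨x, θ⟩ : ℂ) - ∑ n ∈ Finset.range p, a n * Complex.exp (⟨x, θ⟩ : ℂ) ^ n‖
        ≤ C * A ^ p * M p * Real.exp x ^ p)
    (w : ℂ) (hw : ‖f w‖ ≤ K) (hwi : w.im - θ ∈ uIcc 0 b)
    (hwκ : 1 ≤ κ * (1 - (w.im - θ) / b)) (p : ℕ) :
    ‖f w - ∑ n ∈ Finset.range p, a n * Complex.exp w ^ n‖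
        ≤ (K + 4 * C) * (2 * A * B) ^ p * M p * Real.exp w.re ^ p := by
  have ha := coeff_bound hray
  set q := κ * p with hq
  have hpq : p ≤ q := Nat.le_mul_of_pos_left p hκ
  have hm := quot_pos hM q
  set m := quot M q with hmdef
  have hMp := hM.2.1 p
  -- size of the terms
  have term : ∀ (v : ℂ) (n : ℕ), n ≤ q →
      ‖a n * Complex.exp v ^ n‖ ≤ C * ((1 / 2) ^ n * (2 * A * m * Real.exp v.re) ^ n) := by
    intro v n hn
    have h1 : M n ≤ m ^ n := by
      have := M_up hM 0 n q (by omega)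
      simpa [hM.1] using this
    rw [norm_mul, norm_pow, Complex.norm_exp, ← mul_pow]
    calc ‖a n‖ * Real.exp v.re ^ n ≤ C * A ^ n * m ^ n * Real.exp v.re ^ n := by
          refine mul_le_mul_of_nonneg_right ((ha n).trans ?_) (by positivity)
          exact mul_le_mul_of_nonneg_left h1 (by positivity)
      _ = C * (1 / 2 * (2 * A * m * Real.exp v.re)) ^ n := by
          rw [show 1 / 2 * (2 * A * m * Real.exp v.re) = A * m * Real.exp v.re by ring,
            mul_pow, mul_pow]
          ring
  have fin : (2 * A * m * Real.exp w.re) ^ p ≤ (2 * A * B) ^ p * M p * Real.exp w.re ^ p := by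
    rw [mul_pow, mul_pow, mul_pow (2 * A)]
    have := hB p
    calc (2 * A) ^ p * m ^ p * Real.exp w.re ^ p
        ≤ (2 * A) ^ p * (B ^ p * M p) * Real.exp w.re ^ p := by gcongr
      _ = _ := by ring
  set Q := (2 * A * B) ^ p * M p * Real.exp w.re ^ p with hQ
  have hQ0 : 0 ≤ Q := by positivity
  have goalEq : (K + 4 * C) * (2 * A * B) ^ p * M p * Real.exp w.re ^ p = (K + 4 * C) * Q := by
    rw [hQ]; ring
  rw [goalEq]
  rcases le_total 1 (2 * A * m * Real.exp w.re) with hs | hs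
  · -- far from the vertex
    have h1 : ‖∑ n ∈ Finset.range p, a n * Complex.exp w ^ n‖ ≤
        2 * C * (2 * A * m * Real.exp w.re) ^ p := by
      calc ‖∑ n ∈ Finset.range p, a n * Complex.exp w ^ n‖
          ≤ ∑ n ∈ Finset.range p, C * (2 * A * m * Real.exp w.re) ^ p * (1 / 2) ^ n := by
            refine norm_sum_le_of_le _ fun n hn => ?_
            have hn' := Finset.mem_range.1 hn
            refine (term w n (by omega)).trans ?_
            have := pow_le_pow_right₀ hs hn'.le
            calc C * ((1 / 2) ^ n * (2 * A * m * Real.exp w.re) ^ n)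
                ≤ C * ((1 / 2) ^ n * (2 * A * m * Real.exp w.re) ^ p) := by gcongr
              _ = _ := by ring
        _ = C * (2 * A * m * Real.exp w.re) ^ p * ∑ n ∈ Finset.range p, (1 / 2) ^ n := by
            rw [Finset.mul_sum]
        _ ≤ C * (2 * A * m * Real.exp w.re) ^ p * 2 := by
            refine mul_le_mul_of_nonneg_left (sum_geometric_two_le p) (by positivity)
        _ = _ := by ring
    have h2 : (1 : ℝ) ≤ (2 * A * m * Real.exp w.re) ^ p := one_le_pow₀ hs
    have h3 : 1 ≤ Q := h2.trans fin
    calc _ ≤ ‖f w‖ + ‖∑ n ∈ Finset.range p, a n * Complex.exp w ^ n‖ := norm_sub_le _ _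
      _ ≤ K * Q + 2 * C * Q := by
          refine add_le_add (hw.trans (by nlinarith)) (h1.trans ?_)
          exact mul_le_mul_of_nonneg_left fin (by positivity)
      _ ≤ (K + 4 * C) * Q := by nlinarith
  · -- near the vertex
    set x0 := -Real.log (2 * A * m) with hx0
    have h2Am : 0 < 2 * A * m := by positivity
    have hex0 : Real.exp x0 = (2 * A * m)⁻¹ := by
      rw [hx0, Real.exp_neg, Real.exp_log h2Am]
    have hx01 : x0 ≤ x1 := by
      refine le_trans ?_ hx1
      rw [hx0, neg_le_neg_iff]
      refine Real.log_le_log (by have := quot_pos hM 0; positivity) ?_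
      exact mul_le_mul_of_nonneg_left (quot_mono hM (Nat.zero_le _)) (by positivity)
    have hscale : ∀ x : ℝ, 2 * A * m * Real.exp x = Real.exp (x - x0) := by
      intro x
      rw [Real.exp_sub, hex0, div_inv_eq_mul, mul_comm]
    have hwx0 : w.re ≤ x0 := by
      rw [hscale, Real.exp_le_one_iff] at hs; linarith
    set w0 : ℂ := ⟨x0, θ⟩ with hw0
    set F : ℂ → ℂ := fun v =>
      f (w0 + v) - ∑ n ∈ Finset.range q, a n * Complex.exp (w0 + v) ^ n with hF
    have hPL := half_strip F b (K + 2 * C) hb (by positivity) q ?_ ?_ ?_ (w - w0)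
      (by simp [hw0]; exact hwx0) (by simpa [hw0] using hwi)
    · have hre : (w - w0).re = w.re - x0 := by simp [hw0]
      have him : (w - w0).im = w.im - θ := by simp [hw0]
      rw [hre, him] at hPL
      have hFw : F (w - w0) = f w - ∑ n ∈ Finset.range q, a n * Complex.exp w ^ n := by
        simp only [hF, add_sub_cancel]
      rw [hFw] at hPL
      have hq' : (q : ℝ) * ((w.re - x0) * (1 - (w.im - θ) / b)) ≤ p * (w.re - x0) := by
        have e : (q : ℝ) = κ * p := by rw [hq]; push_cast; ring
        have h1 : (p : ℝ) * (w.re - x0) ≤ 0 :=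
          mul_nonpos_of_nonneg_of_nonpos (Nat.cast_nonneg p) (by linarith)
        rw [e]
        nlinarith
      have hPL2 : ‖f w - ∑ n ∈ Finset.range q, a n * Complex.exp w ^ n‖ ≤ (K + 2 * C) * Q := by
        refine hPL.trans (mul_le_mul_of_nonneg_left ?_ (by positivity))
        refine (Real.exp_le_exp.2 hq').trans (le_trans (le_of_eq ?_) fin)
        rw [hscale, ← Real.exp_nat_mul]
      obtain ⟨k, hk⟩ := Nat.exists_eq_add_of_le hpq
      have hsplit : f w - ∑ n ∈ Finset.range p, a n * Complex.exp w ^ n =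
          (f w - ∑ n ∈ Finset.range q, a n * Complex.exp w ^ n) +
            ∑ n ∈ Finset.range k, a (p + n) * Complex.exp w ^ (p + n) := by
        rw [hk, Finset.sum_range_add]; ring
      have htail : ‖∑ n ∈ Finset.range k, a (p + n) * Complex.exp w ^ (p + n)‖ ≤ 2 * C * Q := by
        have hAQ : A ^ p * M p * Real.exp w.re ^ p ≤ Q := by
          rw [hQ]
          have : A ≤ 2 * A * B := by nlinarith
          gcongr
        calc ‖∑ n ∈ Finset.range k, a (p + n) * Complex.exp w ^ (p + n)‖
            ≤ ∑ n ∈ Finset.range k, C * Q * (1 / 2) ^ n := by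
              refine norm_sum_le_of_le _ fun n hn => ?_
              have hn' := Finset.mem_range.1 hn
              rw [norm_mul, norm_pow, Complex.norm_exp]
              have h1 := M_up hM p n q (by omega)
              calc ‖a (p + n)‖ * Real.exp w.re ^ (p + n)
                  ≤ C * A ^ (p + n) * (M p * m ^ n) * Real.exp w.re ^ (p + n) := by
                    refine mul_le_mul_of_nonneg_right ((ha _).trans ?_) (by positivity)
                    exact mul_le_mul_of_nonneg_left h1 (by positivity)
                _ = C * (A ^ p * M p * Real.exp w.re ^ p) *
                      (1 / 2 * (2 * A * m * Real.exp w.re)) ^ n := by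
                    rw [show 1 / 2 * (2 * A * m * Real.exp w.re) = A * m * Real.exp w.re by ring,
                      mul_pow, mul_pow]
                    ring
                _ ≤ C * Q * (1 / 2) ^ n := by
                    have : 1 / 2 * (2 * A * m * Real.exp w.re) ≤ 1 / 2 := by linarith
                    gcongr
          _ = C * Q * ∑ n ∈ Finset.range k, (1 / 2) ^ n := by rw [Finset.mul_sum]
          _ ≤ C * Q * 2 := mul_le_mul_of_nonneg_left (sum_geometric_two_le k) (by positivity)
          _ = _ := by ring
      rw [hsplit]
      refine (norm_add_le _ _).trans ((add_le_add hPL2 htail).trans (le_of_eq ?_))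
      ring
    · -- differentiability
      have hadd : Differentiable ℂ (fun v : ℂ => w0 + v) := by fun_prop
      refine DifferentiableOn.sub ?_ ?_
      · refine hd.comp hadd.differentiableOn ?_
        rintro v ⟨hv1, hv2⟩
        refine ⟨?_, ?_⟩
        · simp [hw0]; linarith
        · simpa [hw0] using hv2
      · refine Differentiable.differentiableOn ?_
        fun_prop
    · -- global bound
      intro v hv1 hv2
      have hr : (w0 + v).re = x0 + v.re := by simp [hw0]
      have hi : (w0 + v).im - θ = v.im := by simp [hw0]
      have hsv : 2 * A * m * Real.exp (w0 + v).re ≤ 1 := by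
        rw [hscale, Real.exp_le_one_iff, hr]; linarith
      refine (norm_sub_le _ _).trans (add_le_add (hK _ (by rw [hr]; linarith)
        (by rw [hi]; exact hv2)) ?_)
      calc ‖∑ n ∈ Finset.range q, a n * Complex.exp (w0 + v) ^ n‖
          ≤ ∑ n ∈ Finset.range q, C * (1 / 2) ^ n := by
            refine norm_sum_le_of_le _ fun n hn => ?_
            refine (term _ n (Finset.mem_range.1 hn).le).trans ?_
            refine mul_le_mul_of_nonneg_left ?_ hC.le
            exact mul_le_of_le_one_right (by positivity) (pow_le_one₀ (by positivity) hsv)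
        _ = C * ∑ n ∈ Finset.range q, (1 / 2) ^ n := by rw [Finset.mul_sum]
        _ ≤ C * 2 := mul_le_mul_of_nonneg_left (sum_geometric_two_le q) hC.le
        _ = 2 * C := by ring
    · -- bound on the ray
      intro v hv1 hv2
      have e : w0 + v = ⟨x0 + v.re, θ⟩ := by
        apply Complex.ext <;> simp [hw0, hv2]
      have h1 := hray (x0 + v.re) (by linarith) q
      simp only [hF]
      rw [e]
      refine h1.trans ?_
      have h2 : M q ≤ m ^ q := by
        have := M_up hM 0 q q (by omega)
        simpa [hM.1] using this
      have h3 : (A * m * Real.exp (x0 + v.re)) ^ q ≤ Real.exp (q * v.re) := by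
        rw [Real.exp_nat_mul]
        have h4 := hscale (x0 + v.re)
        rw [add_sub_cancel_left] at h4
        refine pow_le_pow_left₀ (by positivity) ?_ q
        have : 0 < A * m * Real.exp (x0 + v.re) := by positivity
        linarith
      calc C * A ^ q * M q * Real.exp (x0 + v.re) ^ q
          ≤ C * A ^ q * m ^ q * Real.exp (x0 + v.re) ^ q := by gcongr
        _ = C * (A * m * Real.exp (x0 + v.re)) ^ q := by rw [mul_pow, mul_pow]; ring
        _ ≤ (K + 2 * C) * Real.exp (q * v.re) := by
          refine mul_le_mul (by linarith) h3 (by positivity) (by positivity)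

/-- Closed strips strictly inside `S(0, γ)` give proper subsectors of `G`. -/
lemma exists_sector {γ : ℝ} {G : Set ℂ} (hG : SectorialRegion 0 γ G) {τ : ℝ} (hτ0 : 0 ≤ τ)
    (hτ : τ < γ * π / 2) :
    ∃ β r : ℝ, ProperSubsector G 0 β r ∧ τ < β * π / 2 := by
  have hpi := Real.pi_pos
  obtain ⟨τ1, h1, h2⟩ := exists_between hτ
  obtain ⟨τ2, h3, h4⟩ := exists_between h2
  obtain ⟨ρ, hρ, hsub⟩ := hG.2.2.2 (2 * τ2 / π) (by have : 0 < τ2 := by linarith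
                                                    positivity)
    (by rw [div_lt_iff₀ hpi]; linarith)
  have e1 : 2 * τ1 / π * π / 2 = τ1 := by field_simp
  have e2 : 2 * τ2 / π * π / 2 = τ2 := by field_simp
  refine ⟨2 * τ1 / π, ρ / 2, ⟨?_, by positivity, ?_⟩, by rw [e1]; exact h1⟩
  · have : 0 < τ1 := by linarith
    positivity
  · rintro w ⟨hw1, hw2⟩
    rw [e1] at hw1
    refine hsub ⟨by rw [e2]; linarith, hw2.trans_lt (Real.log_lt_log (by positivity) (by linarith))⟩

lemma exists_kappa {s : ℝ} (h : s < 1) :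
    ∃ κ : ℕ, 0 < κ ∧ ∀ y : ℝ, y ≤ s → 1 ≤ κ * (1 - y) := by
  obtain ⟨n, hn⟩ := exists_nat_ge (1 / (1 - s))
  have h1 : 0 < 1 - s := by linarith
  have hn0 : 0 < (n : ℝ) := lt_of_lt_of_le (by positivity) hn
  refine ⟨n, by exact_mod_cast hn0, fun y hy => ?_⟩
  rw [div_le_iff₀ h1] at hn
  nlinarith

lemma one_side {M : ℕ → ℝ} (hM : GoodSeq M) (hPO : AdmitsNonzeroProximateOrder M)
    {f : ℂ → ℂ} {a : ℕ → ℂ} {θ b s x1 C A K : ℝ}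
    (hb : b ≠ 0) (hs : s < 1) (hC : 0 < C) (hA : 0 < A) (hK0 : 0 ≤ K)
    (hd : DifferentiableOn ℂ f {w : ℂ | w.re ≤ x1 ∧ w.im - θ ∈ uIcc 0 b})
    (hK : ∀ w : ℂ, w.re ≤ x1 → w.im - θ ∈ uIcc 0 b → ‖f w‖ ≤ K)
    (hray : ∀ x : ℝ, x ≤ x1 → ∀ p : ℕ,
      ‖f (⟨x, θ⟩ : ℂ) - ∑ n ∈ Finset.range p, a n * Complex.exp (⟨x, θ⟩ : ℂ) ^ n‖
        ≤ C * A ^ p * M p * Real.exp x ^ p) :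
    ∃ C' A' : ℝ, 0 < C' ∧ 0 < A' ∧ ∀ w : ℂ, ‖f w‖ ≤ K → w.im - θ ∈ uIcc 0 b →
      (w.im - θ) / b ≤ s → ∀ p : ℕ,
        ‖f w - ∑ n ∈ Finset.range p, a n * Complex.exp w ^ n‖
          ≤ C' * A' ^ p * M p * Real.exp w.re ^ p := by
  obtain ⟨κ, hκ, hκs⟩ := exists_kappa hs
  obtain ⟨B, hB1, hB⟩ := mod_growth hM hPO κ hκ
  have hm0 := quot_pos hM 0
  set A1 := max A (Real.exp (-x1) / (2 * quot M 0)) with hA1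
  have hA1pos : 0 < A1 := lt_max_of_lt_left hA
  refine ⟨K + 4 * C, 2 * A1 * B, by positivity, by positivity, fun w h1 h2 h3 p => ?_⟩
  refine core hM hb hC hA1pos hK0 hκ hB1 hB ?_ hd hK ?_ w h1 h2 (hκs _ h3) p
  · have : Real.exp (-x1) / (2 * quot M 0) ≤ A1 := le_max_right _ _
    rw [div_le_iff₀ (by positivity)] at this
    have h4 : -x1 ≤ Real.log (2 * A1 * quot M 0) := by
      rw [Real.le_log_iff_exp_le (by positivity)]
      linarith
    linarith
  · intro x hx p
    refine (hray x hx p).trans ?_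
    have := hM.2.1 p
    have hAA : A ≤ A1 := le_max_left _ _
    gcongr

/-- final Corollary of the paper: the class `Ã_M(G_γ)` coincides with the
set of holomorphic functions on `G_γ` that are bounded in every proper bounded subsector
`T ≪ G_γ` and admit an `M`-asymptotic expansion in the given direction `θ`. -/
theorem class_characterization
    (M : ℕ → ℝ) (hM : GoodSeq M) (hPO : AdmitsNonzeroProximateOrder M)
    (γ : ℝ) (hγ0 : 0 < γ) (G : Set ℂ) (hG : SectorialRegion 0 γ G)
    (θ : ℝ) (hθ : |θ| < γ * π / 2) :
    {f : ℂ → ℂ | DifferentiableOn ℂ f G ∧ ∃ a : ℕ → ℂ, AsympExpandsOn M f a G} =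
      {f : ℂ → ℂ | DifferentiableOn ℂ f G ∧
        (∀ d β r : ℝ, ProperSubsector G d β r →
          ∃ K : ℝ, ∀ w ∈ logSectorB d β r, ‖f w‖ ≤ K) ∧
        ∃ a : ℕ → ℂ, AsympExpandsDir M f a G θ} := by

  have hpi := Real.pi_pos
  ext f
  constructor
  · rintro ⟨hd, a, ha⟩
    refine ⟨hd, fun d β r hT => ?_, a, ?_⟩
    · obtain ⟨C, A, -, -, h⟩ := ha d β r hT
      refine ⟨C, fun w hw => ?_⟩
      simpa [hM.1] using h w hw 0
    · obtain ⟨β, r, hT, hτ⟩ := exists_sector hG (abs_nonneg θ) hθ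
      obtain ⟨C, A, hC, hA, h⟩ := ha 0 β r hT
      have hr := hT.2.1
      have hlog : Real.log (r / 2) < Real.log r := Real.log_lt_log (by positivity) (by linarith)
      refine ⟨r / 2, C, A, by positivity, hC, hA, fun x hx => hT.2.2 ⟨?_, ?_⟩,
        fun x hx p => h ⟨x, θ⟩ ⟨?_, ?_⟩ p⟩
      · simpa using hτ.le
      · exact hx.trans hlog.le
      · simpa using hτ
      · exact hx.trans_lt hlog
  · rintro ⟨hd, hbd, a, r0, C, A, hr0, hC, hA, -, hray⟩
    refine ⟨hd, a, fun d β r hT => ?_⟩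
    obtain ⟨K1, hK1⟩ := hbd d β r hT
    have hTC := hT.2.2
    have hβ := hT.1
    have hβ' : 0 < β * π / 2 := by positivity
    have hup : |d + β * π / 2| < γ * π / 2 := by
      have : (⟨Real.log r, d + β * π / 2⟩ : ℂ) ∈ logSector 0 γ :=
        hG.2.2.1 (hTC ⟨by simp [abs_of_pos hβ'], le_rfl⟩)
      simpa [logSector] using this
    have hlo : |d - β * π / 2| < γ * π / 2 := by
      have : (⟨Real.log r, d - β * π / 2⟩ : ℂ) ∈ logSector 0 γ :=
        hG.2.2.1 (hTC ⟨by simp [abs_of_pos hβ'], le_rfl⟩)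
      simpa [logSector] using this
    set τ := max |θ| (max |d + β * π / 2| |d - β * π / 2|) with hτdef
    have hτ : τ < γ * π / 2 := max_lt hθ (max_lt hup hlo)
    have hτ0 : 0 ≤ τ := (abs_nonneg θ).trans (le_max_left _ _)
    have hθτ : |θ| ≤ τ := le_max_left _ _
    have hTτ : ∀ w ∈ logSectorB d β r, |w.im| ≤ τ := by
      rintro w ⟨hw, -⟩
      have a1 : |d + β * π / 2| ≤ τ := (le_max_left _ _).trans (le_max_right _ _)
      have a2 : |d - β * π / 2| ≤ τ := (le_max_right _ _).trans (le_max_right _ _)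
      rw [abs_lt] at hw
      rw [abs_le] at a1 a2 ⊢
      constructor <;> linarith [a1.1, a1.2, a2.1, a2.2, hw.1, hw.2]
    obtain ⟨β1, r1, hT1, hτ1⟩ := exists_sector hG hτ0 hτ
    obtain ⟨K2, hK2⟩ := hbd 0 β1 r1 hT1
    have hr1 := hT1.2.1
    obtain ⟨τ1, hττ1, hτ1β⟩ := exists_between hτ1
    set x1 := min (Real.log r0) (Real.log r1 - 1) with hx1
    have hx1a : x1 ≤ Real.log r0 := min_le_left _ _
    have hx1b : x1 < Real.log r1 := (min_le_right _ _).trans_lt (by linarith)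
    set K := max (max K1 K2) 0 with hKdef
    have hKK1 : K1 ≤ K := (le_max_left _ _).trans (le_max_left _ _)
    have hKK2 : K2 ≤ K := (le_max_right _ _).trans (le_max_left _ _)
    have hK0 : 0 ≤ K := le_max_right _ _
    have hmem : ∀ w : ℂ, w.re ≤ x1 → |w.im| ≤ τ1 → w ∈ logSectorB 0 β1 r1 := by
      intro w h1 h2
      exact ⟨by rw [sub_zero]; linarith, by linarith⟩
    have hsubG : logSectorB 0 β1 r1 ⊆ G := fun w hw => hT1.2.2 ⟨hw.1.le, hw.2.le⟩
    have hray' : ∀ x : ℝ, x ≤ x1 → ∀ p : ℕ,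
      ‖f (⟨x, θ⟩ : ℂ) - ∑ n ∈ Finset.range p, a n * Complex.exp (⟨x, θ⟩ : ℂ) ^ n‖
        ≤ C * A ^ p * M p * Real.exp x ^ p := fun x hx => hray x (hx.trans hx1a)
    have hθ' := abs_le.1 hθτ
    have hbu : 0 < τ1 - θ := by linarith
    have hbl : -τ1 - θ < 0 := by linarith
    have himu : ∀ w : ℂ, w.im - θ ∈ uIcc 0 (τ1 - θ) → |w.im| ≤ τ1 := by
      intro w hw
      rw [uIcc_of_le hbu.le] at hw
      rw [abs_le]
      constructor <;> linarith [hw.1, hw.2]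
    have himl : ∀ w : ℂ, w.im - θ ∈ uIcc 0 (-τ1 - θ) → |w.im| ≤ τ1 := by
      intro w hw
      rw [uIcc_of_ge hbl.le] at hw
      rw [abs_le]
      constructor <;> linarith [hw.1, hw.2]
    obtain ⟨C1, A1, hC1, hA1, H1⟩ := one_side hM hPO (s := (τ - θ) / (τ1 - θ)) hbu.ne'
      (by rw [div_lt_one hbu]; linarith) hC hA hK0
      (hd.mono fun w hw => hsubG (hmem w hw.1 (himu w hw.2)))
      (fun w h1 h2 => (hK2 w (hmem w h1 (himu w h2))).trans hKK2) hray'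
    obtain ⟨C2, A2, hC2, hA2, H2⟩ := one_side hM hPO (s := (-τ - θ) / (-τ1 - θ)) hbl.ne
      (by rw [div_lt_one_of_neg hbl]; linarith) hC hA hK0
      (hd.mono fun w hw => hsubG (hmem w hw.1 (himl w hw.2)))
      (fun w h1 h2 => (hK2 w (hmem w h1 (himl w h2))).trans hKK2) hray'
    refine ⟨max C1 C2, max A1 A2, lt_max_of_lt_left hC1, lt_max_of_lt_left hA1,
      fun w hw p => ?_⟩
    have hMp := hM.2.1 p
    have hwτ := abs_le.1 (hTτ w hw)
    rcases le_total θ w.im with h | h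
    · refine (H1 w ((hK1 w hw).trans hKK1) ?_ ?_ p).trans ?_
      · rw [uIcc_of_le hbu.le]
        constructor <;> linarith [hwτ.2]
      · exact div_le_div_of_nonneg_right (by linarith [hwτ.2]) hbu.le
      · have e1 := le_max_left C1 C2
        have e2 := le_max_left A1 A2
        gcongr
    · refine (H2 w ((hK1 w hw).trans hKK1) ?_ ?_ p).trans ?_
      · rw [uIcc_of_ge hbl.le]
        constructor <;> linarith [hwτ.1]
      · exact div_le_div_of_nonpos_of_le hbl.le (by linarith [hwτ.1])
      · have e1 := le_max_right C1 C2
        have e2 := le_max_right A1 A2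
        gcongr
end
end

section
/- Let M = (M_p) be a logarithmically convex sequence of positive reals with M_0 = 1, whose quotients m_p := M_{p+1}/M_p tend to infinity, and which admits a nonzero proximate order. Then for every γ > 0 there exists a holomorphic function f on the sector S_γ that is M-flat in the direction 0 but such that lim_{z→0, z real positive} f'(z) does not exist; consequently f does not admit any M-asymptotic expansion in any sectorial region containing the direction 0, and in particular f is not M-flat in any such sectorial region. -/
open Filter Topology Set
open scoped Real

noncomputable section

def auxF (K : ℕ) : ℂ → ℂ := fun w =>
  Complex.exp (-Complex.exp (-(K : ℂ) * w)) * Complex.sin (Complex.exp (2 * Complex.exp (-(K : ℂ) * w)))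

lemma auxF_hasDeriv (K : ℕ) (w : ℂ) : HasDerivAt (auxF K)
    (-(K : ℂ) * Complex.exp (-(K : ℂ) * w) *
      (-Complex.exp (-Complex.exp (-(K : ℂ) * w)) * Complex.sin (Complex.exp (2 * Complex.exp (-(K : ℂ) * w)))
       + 2 * Complex.exp (-Complex.exp (-(K : ℂ) * w)) * Complex.exp (2 * Complex.exp (-(K : ℂ) * w))
          * Complex.cos (Complex.exp (2 * Complex.exp (-(K : ℂ) * w))))) w := by
  have h0 : HasDerivAt (fun w : ℂ => Complex.exp (-(K : ℂ) * w))
      (Complex.exp (-(K : ℂ) * w) * (-(K : ℂ) * 1)) w :=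
    ((hasDerivAt_id w).const_mul (-(K : ℂ))).cexp
  have h1 := h0.neg.cexp
  have h2 := ((h0.const_mul 2).cexp).csin
  have h3 := h1.mul h2
  refine h3.congr_deriv ?_
  simp only [Pi.neg_apply]
  ring

lemma auxF_diff (K : ℕ) : Differentiable ℂ (auxF K) := fun w => (auxF_hasDeriv K w).differentiableAt

lemma auxF_real (K : ℕ) (x : ℝ) :
    auxF K (x : ℂ) = ((Real.exp (-Real.exp (-(K : ℝ) * x)) *
      Real.sin (Real.exp (2 * Real.exp (-(K : ℝ) * x))) : ℝ) : ℂ) := by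
  simp only [auxF]
  push_cast
  rfl

lemma auxF_norm_le (K : ℕ) (x : ℝ) : ‖auxF K (x : ℂ)‖ ≤ Real.exp (-Real.exp (-(K : ℝ) * x)) := by
  rw [auxF_real, Complex.norm_real, Real.norm_eq_abs, abs_mul, Real.abs_exp]
  exact mul_le_of_le_one_right (Real.exp_pos _).le (Real.abs_sin_le_one _)

lemma auxF_unbounded (K : ℕ) (hK : 1 ≤ K) (B X : ℝ) :
    ∃ x : ℝ, x ≤ X ∧ B < ‖zderiv (auxF K) (x : ℂ)‖ := by
  obtain ⟨n, hn⟩ := exists_nat_ge (Real.exp (2 * (|B| + 1 + Real.exp (-(K : ℝ) * X))))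
  have hKR : (1 : ℝ) ≤ K := by exact_mod_cast hK
  have hK0 : (0 : ℝ) < K := by linarith
  set V := |B| + 1 + Real.exp (-(K : ℝ) * X) with hV
  have hn0 : (0 : ℝ) < n := lt_of_lt_of_le (Real.exp_pos _) hn
  have hπ := Real.pi_gt_three
  have h2n : (n : ℝ) ≤ n * (2 * π) := by nlinarith
  have hpos : (0 : ℝ) < n * (2 * π) := by positivity
  set u := Real.log (n * (2 * π)) / 2 with hu
  have huV : V ≤ u := by
    have : 2 * V ≤ Real.log (n * (2 * π)) := by
      rw [Real.le_log_iff_exp_le hpos]; linarith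
    rw [hu]; linarith
  have hE := Real.exp_pos (-(K : ℝ) * X)
  have hB := abs_nonneg B
  have hu1 : 1 ≤ u := by linarith
  have hu0 : 0 < u := by linarith
  have hexp2u : Real.exp (2 * u) = n * (2 * π) := by
    rw [hu, mul_div_cancel₀ _ (by norm_num : (2:ℝ) ≠ 0), Real.exp_log hpos]
  set x := -Real.log u / K with hx
  have hKx : Real.exp (-(K : ℝ) * x) = u := by
    have : -(K : ℝ) * x = Real.log u := by rw [hx]; field_simp
    rw [this, Real.exp_log hu0]
  have hx0 : x ≤ 0 := by
    rw [hx]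
    exact div_nonpos_of_nonpos_of_nonneg (by linarith [Real.log_nonneg hu1]) hK0.le
  refine ⟨x, ?_, ?_⟩
  · have h1 : Real.exp (-(K : ℝ) * X) ≤ Real.exp (-(K : ℝ) * x) := by rw [hKx]; linarith
    rw [Real.exp_le_exp] at h1
    nlinarith
  · have hcu : Complex.exp (-(K : ℂ) * (x : ℂ)) = (u : ℂ) := by
      rw [← hKx]; push_cast; rfl
    have hc2 : Complex.exp (2 * (u : ℂ)) = ((n * (2 * π) : ℝ) : ℂ) := by
      rw [← hexp2u]; push_cast; rfl
    have hd : zderiv (auxF K) (x : ℂ) =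
        ((Real.exp (-x) * (-(K : ℝ) * u * (2 * Real.exp (-u) * Real.exp (2 * u))) : ℝ) : ℂ) := by
      unfold zderiv
      rw [(auxF_hasDeriv K x).deriv, hcu, hc2, ← Complex.ofReal_sin, ← Complex.ofReal_cos,
        Real.cos_nat_mul_two_pi,
        show Real.sin (n * (2 * π)) = 0 by
          have := Real.sin_nat_mul_pi (2 * n)
          push_cast at this
          rw [← this]; congr 1; ring,
        hexp2u]
      push_cast
      ring
    have he : Real.exp (-u) * Real.exp (2 * u) = Real.exp u := by
      rw [← Real.exp_add]; congr 1; ring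
    have hval : |Real.exp (-x) * (-(K : ℝ) * u * (2 * Real.exp (-u) * Real.exp (2 * u)))|
        = Real.exp (-x) * (K * u * (2 * Real.exp u)) := by
      rw [mul_assoc 2, he, neg_mul, neg_mul, mul_neg, abs_neg, abs_of_nonneg (by positivity)]
    rw [hd, Complex.norm_real, Real.norm_eq_abs, hval]
    have e1 : 1 ≤ Real.exp (-x) := Real.one_le_exp (by linarith)
    have e2 : 1 ≤ Real.exp u := Real.one_le_exp hu0.le
    have e3 : u ≤ K * u := by nlinarith
    have e4 : u ≤ K * u * (2 * Real.exp u) := by nlinarith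
    have e5 : u ≤ Real.exp (-x) * (K * u * (2 * Real.exp u)) := by nlinarith
    have := le_abs_self B
    linarith

lemma bdd_assoc (M : ℕ → ℝ) (hM : GoodSeq M) (t : ℝ) (ht : 0 < t) :
    BddAbove (Set.range fun p : ℕ => Real.log (t ^ p / M p)) := by
  obtain ⟨-, hpos, -, hlim⟩ := hM
  obtain ⟨N, hN⟩ := eventually_atTop.1 (hlim.eventually_ge_atTop t)
  have hstep : ∀ p, N ≤ p → t ^ p / M p ≤ t ^ N / M N := by
    intro p hp
    induction p, hp using Nat.le_induction with
    | base => exact le_rfl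
    | succ p hp ih =>
      refine le_trans ?_ ih
      have h := hN p hp
      rw [le_div_iff₀ (hpos p)] at h
      rw [div_le_div_iff₀ (hpos _) (hpos _), pow_succ]
      have := pow_pos ht p
      nlinarith
  have hfin : BddAbove ((fun p : ℕ => Real.log (t ^ p / M p)) '' (Set.Iic N)) :=
    ((Set.finite_Iic N).image _).bddAbove
  obtain ⟨b, hb⟩ := hfin
  refine ⟨b, ?_⟩
  rintro _ ⟨p, rfl⟩
  rcases le_total p N with h | h
  · exact hb ⟨p, h, rfl⟩
  · refine le_trans ?_ (hb ⟨N, le_refl N, rfl⟩)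
    exact Real.log_le_log (div_pos (pow_pos ht p) (hpos p)) (hstep p h)

lemma exists_K (M : ℕ → ℝ) (hPO : AdmitsNonzeroProximateOrder M) :
    ∃ K : ℕ, 1 ≤ K ∧ ∀ᶠ t : ℝ in atTop, assocM M t ≤ t ^ K := by
  obtain ⟨c, l, ρ, hl, ⟨-, -, hlim, -⟩, A, B, hAB⟩ := hPO
  obtain ⟨K, hK⟩ := exists_nat_ge (l + 2)
  refine ⟨K, ?_, ?_⟩
  · have : (1 : ℝ) ≤ K := by linarith
    exact_mod_cast this
  have hρ := hlim.eventually_le_const (show l < l + 1 by linarith)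
  filter_upwards [hAB, hρ, eventually_gt_atTop 1,
    Real.tendsto_log_atTop.eventually_ge_atTop (-A)] with t h1 h2 h3 h4
  have hlog : 0 < Real.log t := Real.log_pos h3
  have ht0 : 0 < t := by linarith
  rcases le_or_gt (assocM M t) 0 with h | h
  · exact h.trans (pow_nonneg ht0.le K)
  rw [← Real.log_le_log_iff h (pow_pos ht0 K), Real.log_pow]
  have h5 := h1.1
  rw [mul_sub, mul_div_cancel₀ _ hlog.ne'] at h5
  nlinarith

lemma auxF_flat (M : ℕ → ℝ) (hM : GoodSeq M) (K : ℕ)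
    (hK : ∀ᶠ t : ℝ in atTop, assocM M t ≤ t ^ K) (D : Set ℂ)
    (hD : ∀ x : ℝ, (⟨x, 0⟩ : ℂ) ∈ D) : MFlatDir M (auxF K) D 0 := by
  obtain ⟨T, hT⟩ := eventually_atTop.1 hK
  refine ⟨(max T 1)⁻¹, 1, 1, by positivity, one_pos, one_pos, fun x _ => hD x, ?_⟩
  intro x hx p
  rw [Real.log_inv] at hx
  have hm : 0 < max T 1 := by positivity
  have ht : T ≤ Real.exp (-x) := by
    refine (le_max_left T 1).trans ?_
    rw [← Real.log_le_iff_le_exp hm]; linarith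
  have h1 := hT _ ht
  have h2 : Real.log (Real.exp (-x) ^ p / M p) ≤ assocM M (Real.exp (-x)) :=
    le_ciSup (bdd_assoc M hM _ (Real.exp_pos _)) p
  have hMp := hM.2.1 p
  have h3 : Real.exp (-x) ^ p / M p ≤ Real.exp (Real.exp (-(K : ℝ) * x)) := by
    rw [← Real.log_le_iff_le_exp (by positivity)]
    refine (h2.trans h1).trans (le_of_eq ?_)
    rw [← Real.exp_nat_mul]; congr 1; ring
  refine (auxF_norm_le K x).trans ?_
  rw [one_pow, one_mul, one_mul, Real.exp_neg, inv_le_comm₀ (Real.exp_pos _) (by positivity)]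
  refine le_trans (le_of_eq ?_) h3
  rw [Real.exp_neg, mul_inv, inv_pow]; field_simp

lemma expand_bdd (M : ℕ → ℝ) (f : ℂ → ℂ) (hf : Differentiable ℂ f) (a : ℕ → ℂ) (d' γ' : ℝ)
    (G : Set ℂ) (hG : SectorialRegion d' γ' G) (hd : |d'| < γ' * π / 2)
    (ha : AsympExpandsOn M f a G) :
    ∃ B X : ℝ, ∀ x : ℝ, x ≤ X → ‖zderiv f (x : ℂ)‖ ≤ B := by
  have hπ := Real.pi_pos
  obtain ⟨β, hβ1, hβ2⟩ := exists_between (show 2 * |d'| / π < γ' by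
    rw [div_lt_iff₀ hπ]; linarith)
  rw [div_lt_iff₀ hπ] at hβ1
  have hβ0 : 0 < β := by
    have := abs_nonneg d'
    by_contra h
    push Not at h
    nlinarith
  obtain ⟨ρ, hρ, hsub⟩ := hG.2.2.2 β hβ0 hβ2
  -- half-opening of the small sector
  set δ := (β * π / 2 - |d'|) / 2 with hδ
  have hδ0 : 0 < δ := by rw [hδ]; linarith
  have hb : 2 * δ / π * π / 2 = δ := by field_simp
  have hps : ProperSubsector G 0 (2 * δ / π) (ρ / 2) := by
    refine ⟨by positivity, by positivity, ?_⟩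
    rintro w ⟨hw1, hw2⟩
    apply hsub
    rw [hb, sub_zero] at hw1
    refine ⟨?_, hw2.trans_lt (Real.log_lt_log (by positivity) (by linarith))⟩
    have := abs_sub w.im d'
    linarith
  obtain ⟨C, A, hC, hA, hCA⟩ := ha _ _ _ hps
  set C' := C * A * M 1 with hC'
  have hbound : ∀ w : ℂ, |w.im| < δ → w.re < Real.log (ρ / 2) → ‖f w - a 0‖ ≤ C' * Real.exp w.re := by
    intro w h1 h2
    have := hCA w ⟨by rw [hb, sub_zero]; exact h1, h2⟩ 1
    simpa using this
  refine ⟨|C'| * Real.exp (δ / 2) / (δ / 2), Real.log (ρ / 2) - δ, ?_⟩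
  intro x hx
  have hder : ‖deriv (fun w => f w - a 0) (x : ℂ)‖ ≤ (|C'| * Real.exp (x + δ / 2)) / (δ / 2) := by
    refine Complex.norm_deriv_le_of_forall_mem_sphere_norm_le (by positivity)
      ((hf.sub_const _).diffContOnCl) ?_
    intro z hz
    rw [mem_sphere_iff_norm] at hz
    have h1 := Complex.abs_im_le_norm (z - x)
    have h2 := Complex.abs_re_le_norm (z - x)
    rw [hz] at h1 h2
    simp only [Complex.sub_im, Complex.ofReal_im, sub_zero, Complex.sub_re, Complex.ofReal_re] at h1 h2
    have h3 := (abs_le.1 h2).2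
    refine (hbound z (by linarith) (by linarith)).trans ?_
    exact mul_le_mul (le_abs_self _) (Real.exp_le_exp.2 (by linarith)) (Real.exp_pos _).le
      (abs_nonneg _)
  rw [deriv_sub_const] at hder
  unfold zderiv
  rw [norm_mul, Complex.norm_exp]
  simp only [Complex.neg_re, Complex.ofReal_re]
  calc Real.exp (-x) * ‖deriv f (x : ℂ)‖
      ≤ Real.exp (-x) * ((|C'| * Real.exp (x + δ / 2)) / (δ / 2)) :=
        mul_le_mul_of_nonneg_left hder (Real.exp_pos _).le
    _ = |C'| * Real.exp (δ / 2) / (δ / 2) := by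
        rw [Real.exp_add, Real.exp_neg]
        field_simp

/-- Example 3.8 of the paper: for every `γ > 0` there is a holomorphic
function `f` on `S_γ` that is `M`-flat in direction `0`, but whose derivative `f'(z)` has
no limit as `z → 0` along the positive real axis; consequently `f` admits no
`M`-asymptotic expansion (and in particular is not `M`-flat) in any sectorial region
contained in `S_γ` and containing the direction `0`. -/
theorem flat_in_direction_not_in_region
    (M : ℕ → ℝ) (hM : GoodSeq M) (hPO : AdmitsNonzeroProximateOrder M)
    (γ : ℝ) (hγ0 : 0 < γ) :
    ∃ f : ℂ → ℂ, DifferentiableOn ℂ f (logSector 0 γ) ∧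
      MFlatDir M f (logSector 0 γ) 0 ∧
      (¬ ∃ L : ℂ, Tendsto (fun x : ℝ => zderiv f ⟨x, 0⟩) atBot (𝓝 L)) ∧
      (∀ d' γ' : ℝ, ∀ G : Set ℂ, 0 < γ' → SectorialRegion d' γ' G →
        |d'| < γ' * π / 2 → G ⊆ logSector 0 γ →
          (¬ ∃ a : ℕ → ℂ, AsympExpandsOn M f a G) ∧
          ¬ AsympExpandsOn M f (fun _ => 0) G) := by
  obtain ⟨K, hK1, hK⟩ := exists_K M hPO
  have key : ∀ d' γ' : ℝ, ∀ G : Set ℂ, SectorialRegion d' γ' G →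
      |d'| < γ' * π / 2 → ∀ a : ℕ → ℂ, ¬ AsympExpandsOn M (auxF K) a G := by
    intro d' γ' G hG hd a ha
    obtain ⟨B, X, hBX⟩ := expand_bdd M (auxF K) (auxF_diff K) a d' γ' G hG hd ha
    obtain ⟨x, hx, hlt⟩ := auxF_unbounded K hK1 B X
    exact absurd (hBX x hx) (not_le.2 hlt)
  refine ⟨auxF K, (auxF_diff K).differentiableOn, ?_, ?_, ?_⟩
  · refine auxF_flat M hM K hK _ ?_
    intro x
    simp only [logSector, Set.mem_ofPred_eq, sub_zero, abs_zero]
    positivity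
  · rintro ⟨L, hL⟩
    have h := hL.norm.eventually_le_const (show ‖L‖ < ‖L‖ + 1 by linarith)
    obtain ⟨X, hX⟩ := eventually_atBot.1 h
    obtain ⟨x, hx, hlt⟩ := auxF_unbounded K hK1 (‖L‖ + 1) X
    exact absurd (hX x hx) (not_le.2 hlt)
  · intro d' γ' G _ hG hd _
    exact ⟨fun ⟨a, ha⟩ => key d' γ' G hG hd a ha, key d' γ' G hG hd _⟩
end
end
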